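/- Let f : I → I be C¹ with 0 < f'(x) for all x, f(I) ⊆ interior relative bounds, and contraction on average fails pointwise nowhere: if lim_{n→∞} (1/n) log ‖f_ω^n‖ = λ < 0 ν-a.s. holds for a skew product F, then for any ε > 0 there exists δ > 0 such that any skew product G with fiber maps g_ω satisfying dist_{C¹}(g_ω, f_{ω₀}) < δ for all ω has ν-a.s. fiber Lyapunov exponent limsup_{n→∞} (1/n) log ‖g^n(ω, ·)‖ ≤ λ + ε < 0. -/

import Mathlib

open Set Filter Topology MeasureTheory

/-- The left shift on the two-sided sequence space `Σ_k = {0,…,k−1}^ℤ`. -/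
def shiftZ {k : ℕ} (ω : ℤ → Fin k) : ℤ → Fin k := fun i => ω (i + 1)

/-- Lipschitz seminorm of a map, computed over the unit interval `I = [0,1]`. -/
noncomputable def lipSemi (f : ℝ → ℝ) : ℝ :=
  sSup {r : ℝ | ∃ x ∈ Icc (0:ℝ) 1, ∃ y ∈ Icc (0:ℝ) 1, x ≠ y ∧ r = |f x - f y| / |x - y|}

/-- Fiber compositions `g^n(ω, x) = g_{σ^{n−1}ω}(⋯ g_ω(x)⋯)`. -/
def fibIter {k : ℕ} (F : (ℤ → Fin k) → ℝ → ℝ) : ℕ → (ℤ → Fin k) → ℝ → ℝ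
  | 0, _, x => x
  | n + 1, ω, x => fibIter F n (shiftZ ω) (F ω x)

/-- Derivative cocycle. -/
def dCoc {k : ℕ} (g g' : (ℤ → Fin k) → ℝ → ℝ) : ℕ → (ℤ → Fin k) → ℝ → ℝ
  | 0, _, _ => 1
  | n + 1, ω, x => dCoc g g' n (shiftZ ω) (g ω x) * g' ω x

/-- Regularity package for a fibre family. -/
structure Good {k : ℕ} (g g' : (ℤ → Fin k) → ℝ → ℝ) (c M : ℝ) : Prop where
  maps : ∀ ω, MapsTo (g ω) (Icc (0:ℝ) 1) (Icc (0:ℝ) 1)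
  der : ∀ ω, ∀ x ∈ Icc (0:ℝ) 1, HasDerivAt (g ω) (g' ω x) x
  cpos : 0 < c
  cle : c ≤ 1
  leM : 1 ≤ M
  lb : ∀ ω, ∀ x ∈ Icc (0:ℝ) 1, c ≤ g' ω x
  ub : ∀ ω, ∀ x ∈ Icc (0:ℝ) 1, g' ω x ≤ M

section det
variable {k : ℕ} {g g' : (ℤ → Fin k) → ℝ → ℝ} {c M : ℝ}

lemma Good.iter_mem (h : Good g g' c M) (n : ℕ) : ∀ (ω : ℤ → Fin k), ∀ x ∈ Icc (0:ℝ) 1,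
    fibIter g n ω x ∈ Icc (0:ℝ) 1 := by
  induction n with
  | zero => intro ω x hx; exact hx
  | succ n ih => intro ω x hx; exact ih _ _ (h.maps ω hx)

lemma Good.iter_der (h : Good g g' c M) (n : ℕ) : ∀ (ω : ℤ → Fin k), ∀ x ∈ Icc (0:ℝ) 1,
    HasDerivAt (fibIter g n ω) (dCoc g g' n ω x) x := by
  induction n with
  | zero => intro ω x hx; exact hasDerivAt_id x
  | succ n ih =>
    intro ω x hx
    exact HasDerivAt.comp x (ih (shiftZ ω) _ (h.maps ω hx)) (h.der ω x hx)

lemma Good.dCoc_lb (h : Good g g' c M) (n : ℕ) : ∀ (ω : ℤ → Fin k), ∀ x ∈ Icc (0:ℝ) 1,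
    c ^ n ≤ dCoc g g' n ω x := by
  induction n with
  | zero => intro ω x hx; simp [dCoc]
  | succ n ih =>
    intro ω x hx
    have h1 := ih (shiftZ ω) _ (h.maps ω hx)
    have h2 := h.lb ω x hx
    have h0 := h.cpos
    rw [pow_succ]
    exact mul_le_mul h1 h2 h0.le (le_trans (by positivity) h1)

lemma Good.dCoc_pos (h : Good g g' c M) (n : ℕ) (ω : ℤ → Fin k) (x : ℝ) (hx : x ∈ Icc (0:ℝ) 1) :
    0 < dCoc g g' n ω x := lt_of_lt_of_le (pow_pos h.cpos n) (h.dCoc_lb n ω x hx)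

lemma Good.dCoc_ub (h : Good g g' c M) (n : ℕ) : ∀ (ω : ℤ → Fin k), ∀ x ∈ Icc (0:ℝ) 1,
    dCoc g g' n ω x ≤ M ^ n := by
  induction n with
  | zero => intro ω x hx; simp [dCoc]
  | succ n ih =>
    intro ω x hx
    have h1 := ih (shiftZ ω) _ (h.maps ω hx)
    have h2 := h.ub ω x hx
    have h3 := (h.cpos.trans_le (h.lb ω x hx)).le
    have h4 := h.leM
    rw [pow_succ]
    exact mul_le_mul h1 h2 h3 (by positivity)

lemma dCoc_add (g g' : (ℤ → Fin k) → ℝ → ℝ) (a b : ℕ) : ∀ (ω : ℤ → Fin k) (x : ℝ),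
    dCoc g g' (a + b) ω x = dCoc g g' b (shiftZ^[a] ω) (fibIter g a ω x) * dCoc g g' a ω x := by
  induction a with
  | zero => intro ω x; simp [dCoc, fibIter]
  | succ a ih =>
    intro ω x
    rw [show a + 1 + b = (a + b) + 1 by ring]
    simp only [dCoc, fibIter, Function.iterate_succ_apply]
    rw [ih]; ring

lemma Good.quot_le (h : Good g g' c M) (n : ℕ) (ω : ℤ → Fin k) {C : ℝ}
    (hC : ∀ x ∈ Icc (0:ℝ) 1, dCoc g g' n ω x ≤ C) :
    ∀ r ∈ {r : ℝ | ∃ x ∈ Icc (0:ℝ) 1, ∃ y ∈ Icc (0:ℝ) 1, x ≠ y ∧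
      r = |fibIter g n ω x - fibIter g n ω y| / |x - y|}, r ≤ C := by
  rintro r ⟨x, hx, y, hy, hxy, rfl⟩
  have := Convex.norm_image_sub_le_of_norm_hasDerivWithin_le (C := C) (s := Icc (0:ℝ) 1)
    (fun z hz => (h.iter_der n ω z hz).hasDerivWithinAt)
    (fun z hz => by
      rw [Real.norm_eq_abs, abs_of_pos (h.dCoc_pos n ω z hz)]; exact hC z hz)
    (convex_Icc 0 1) hy hx
  rw [div_le_iff₀ (abs_pos.2 (sub_ne_zero.2 hxy))]
  simpa using this

lemma Good.lip_le (h : Good g g' c M) (n : ℕ) (ω : ℤ → Fin k) {C : ℝ}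
    (hC : ∀ x ∈ Icc (0:ℝ) 1, dCoc g g' n ω x ≤ C) : lipSemi (fibIter g n ω) ≤ C := by
  refine csSup_le ⟨_, 0, by simp, 1, by simp, by simp, rfl⟩ (h.quot_le n ω hC)

lemma Good.le_lip (h : Good g g' c M) (n : ℕ) (ω : ℤ → Fin k) (x : ℝ) (hx : x ∈ Icc (0:ℝ) 1) :
    dCoc g g' n ω x ≤ lipSemi (fibIter g n ω) := by
  have hbdd : BddAbove {r : ℝ | ∃ x ∈ Icc (0:ℝ) 1, ∃ y ∈ Icc (0:ℝ) 1, x ≠ y ∧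
      r = |fibIter g n ω x - fibIter g n ω y| / |x - y|} :=
    ⟨M ^ n, h.quot_le n ω (h.dCoc_ub n ω)⟩
  have ht := hasDerivWithinAt_iff_tendsto_slope.1
    ((h.iter_der n ω x hx).hasDerivWithinAt (s := Icc (0:ℝ) 1))
  have hne : (𝓝[Icc (0:ℝ) 1 \ {x}] x).NeBot := by
    have := (uniqueDiffOn_Icc (zero_lt_one' ℝ)) x hx
    exact accPt_principal_iff_nhdsWithin.1 (this.accPt)
  refine le_of_tendsto ht ?_
  filter_upwards [self_mem_nhdsWithin] with y hy
  refine le_trans ?_ (le_csSup hbdd ⟨y, hy.1, x, hx, hy.2, rfl⟩)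
  rw [slope_def_field, ← abs_div]
  exact le_abs_self _

lemma Good.lip_pos (h : Good g g' c M) (n : ℕ) (ω : ℤ → Fin k) :
    0 < lipSemi (fibIter g n ω) :=
  (h.dCoc_pos n ω 0 (by simp)).trans_le (h.le_lip n ω 0 (by simp))

lemma Good.log_lb (h : Good g g' c M) (n : ℕ) (ω : ℤ → Fin k) :
    n * Real.log c ≤ Real.log (lipSemi (fibIter g n ω)) := by
  rw [← Real.log_pow]
  exact Real.log_le_log (pow_pos h.cpos n)
    ((h.dCoc_lb n ω 0 (by simp)).trans (h.le_lip n ω 0 (by simp)))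

lemma Good.log_ub (h : Good g g' c M) (n : ℕ) (ω : ℤ → Fin k) :
    Real.log (lipSemi (fibIter g n ω)) ≤ n * Real.log M := by
  rw [← Real.log_pow]
  exact Real.log_le_log (h.lip_pos n ω) (h.lip_le n ω (h.dCoc_ub n ω))

/-- Block bound. -/
lemma Good.block (h : Good g g' c M) (N : ℕ) (L : (ℤ → Fin k) → ℝ)
    (hL : ∀ ω, ∀ x ∈ Icc (0:ℝ) 1, dCoc g g' N ω x ≤ L ω) (r : ℕ) (m : ℕ) :
    ∀ (ω : ℤ → Fin k), ∀ x ∈ Icc (0:ℝ) 1,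
    dCoc g g' (N * m + r) ω x ≤ (∏ j ∈ Finset.range m, L (shiftZ^[N * j] ω)) * M ^ r := by
  induction m with
  | zero => intro ω x hx; simpa using h.dCoc_ub r ω x hx
  | succ m ih =>
    intro ω x hx
    rw [show N * (m + 1) + r = N + (N * m + r) by ring, dCoc_add, Finset.prod_range_succ']
    have h1 := ih (shiftZ^[N] ω) _ (h.iter_mem N ω x hx)
    have h2 := hL ω x hx
    have e : ∀ j, shiftZ^[N * (j + 1)] ω = shiftZ^[N * j] (shiftZ^[N] ω) := by
      intro j; rw [← Function.iterate_add_apply]; rfl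
    simp only [e]
    have h3 := mul_le_mul h1 h2 (h.dCoc_pos N ω x hx).le
      ((h.dCoc_pos _ _ _ (h.iter_mem N ω x hx)).le.trans h1)
    refine h3.trans (le_of_eq ?_)
    simp only [mul_zero, Function.iterate_zero, id]
    ring

lemma Good.log_block (h : Good g g' c M) (N : ℕ) (hN : 0 < N) (L : (ℤ → Fin k) → ℝ)
    (hL : ∀ ω, ∀ x ∈ Icc (0:ℝ) 1, dCoc g g' N ω x ≤ L ω) (n : ℕ) (ω : ℤ → Fin k) :
    Real.log (lipSemi (fibIter g n ω)) ≤
      (∑ j ∈ Finset.range (n / N), Real.log (L (shiftZ^[N * j] ω))) + N * Real.log M := by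
  have hLpos : ∀ ω, 0 < L ω := fun ω => (h.dCoc_pos N ω 0 (by simp)).trans_le (hL ω 0 (by simp))
  have hM : 0 < M := one_pos.trans_le h.leM
  have h1 : lipSemi (fibIter g n ω) ≤
      (∏ j ∈ Finset.range (n / N), L (shiftZ^[N * j] ω)) * M ^ (n % N) := by
    refine h.lip_le n ω fun x hx => ?_
    have := h.block N L hL (n % N) (n / N) ω x hx
    rwa [Nat.div_add_mod] at this
  have h2 := Real.log_le_log (h.lip_pos n ω) h1
  rw [Real.log_mul (Finset.prod_ne_zero_iff.2 fun j _ => (hLpos _).ne') (by positivity),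
    Real.log_prod (fun j _ => (hLpos _).ne'), Real.log_pow] at h2
  have h3 : ((n % N : ℕ) : ℝ) * Real.log M ≤ N * Real.log M := by
    have := Real.log_nonneg h.leM
    have h4 : ((n % N : ℕ) : ℝ) ≤ N := by exact_mod_cast (Nat.mod_lt n hN).le
    gcongr
  linarith

/-- Perturbation estimate. -/
lemma perturb {F F' : (ℤ → Fin k) → ℝ → ℝ} (h : Good F F' c M)
    (huc : ∀ η > 0, ∃ θ > 0, ∀ ω, ∀ x ∈ Icc (0:ℝ) 1, ∀ y ∈ Icc (0:ℝ) 1, |x - y| < θ →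
      |F' ω x - F' ω y| < η) (κ : ℝ) (hκ : 0 < κ) (n : ℕ) :
    ∃ ρ > 0, ∃ δ > 0, ∀ (g g' : (ℤ → Fin k) → ℝ → ℝ) (c1 M1 : ℝ), Good g g' c1 M1 →
      (∀ ω, ∀ x ∈ Icc (0:ℝ) 1, |g ω x - F ω x| < δ ∧ |g' ω x - F' ω x| < δ) →
      ∀ ω, ∀ x ∈ Icc (0:ℝ) 1, ∀ y ∈ Icc (0:ℝ) 1, |x - y| < ρ →
      dCoc g g' n ω x ≤ (1 + κ) ^ n * dCoc F F' n ω y := by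
  have hc := h.cpos
  have hM : 0 < M := one_pos.trans_le h.leM
  induction n with
  | zero => exact ⟨1, one_pos, 1, one_pos, by intros; simp [dCoc]⟩
  | succ n ih =>
    obtain ⟨ρ, hρ, δ, hδ, H⟩ := ih
    obtain ⟨θ, hθ, Hθ⟩ := huc (κ * c / 2) (by positivity)
    refine ⟨min θ (ρ / (2 * M)), by positivity, min δ (min (ρ / 2) (κ * c / 2)), by positivity, ?_⟩
    intro g g' c1 M1 hg hclose ω x hx y hy hxy
    have hxy1 := hxy.trans_le (min_le_left _ _)
    have hxy2 := hxy.trans_le (min_le_right _ _)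
    have hcl := hclose ω x hx
    have hg1 : |g ω x - F ω x| < ρ / 2 :=
      hcl.1.trans_le ((min_le_right _ _).trans (min_le_left _ _))
    have hg2 : |g' ω x - F' ω x| < κ * c / 2 :=
      hcl.2.trans_le ((min_le_right _ _).trans (min_le_right _ _))
    have hLip : |F ω x - F ω y| ≤ M * |x - y| := by
      have := Convex.norm_image_sub_le_of_norm_hasDerivWithin_le (C := M) (s := Icc (0:ℝ) 1)
        (fun z hz => (h.der ω z hz).hasDerivWithinAt)
        (fun z hz => by
          rw [Real.norm_eq_abs, abs_of_pos (hc.trans_le (h.lb ω z hz))]; exact h.ub ω z hz)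
        (convex_Icc 0 1) hy hx
      simpa using this
    have hLip2 : M * |x - y| < ρ / 2 := by
      rw [lt_div_iff₀ (by positivity)] at hxy2
      linarith
    have hd : |g ω x - F ω y| < ρ := by
      have := abs_sub_le (g ω x) (F ω x) (F ω y)
      linarith
    have h1 := H g g' c1 M1 hg
      (fun ω x hx => ⟨(hclose ω x hx).1.trans_le (min_le_left _ _),
        (hclose ω x hx).2.trans_le (min_le_left _ _)⟩)
      (shiftZ ω) _ (hg.maps ω hx) _ (h.maps ω hy) hd
    have h2 : g' ω x ≤ (1 + κ) * F' ω y := by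
      have a := (abs_lt.1 hg2).2
      have b := (abs_lt.1 (Hθ ω x hx y hy hxy1)).2
      have e := h.lb ω y hy
      nlinarith
    have h3 := mul_le_mul h1 h2 (hg.cpos.trans_le (hg.lb ω x hx)).le
      ((hg.dCoc_pos _ _ _ (hg.maps ω hx)).le.trans h1)
    refine h3.trans (le_of_eq ?_)
    simp only [dCoc]
    ring

lemma shift_iter (m : ℕ) : ∀ ω : ℤ → Fin k, shiftZ^[m] ω = fun i => ω (i + m) := by
  induction m with
  | zero => intro ω; simp
  | succ m ih =>
    intro ω
    rw [Function.iterate_succ_apply, ih]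
    funext i
    simp only [shiftZ]
    congr 1; push_cast; ring

lemma fibIter_congr {F : (ℤ → Fin k) → ℝ → ℝ} {f : Fin k → ℝ → ℝ} (hF : ∀ ω, F ω = f (ω 0))
    (n : ℕ) : ∀ ω ω' : ℤ → Fin k, (∀ i : ℤ, 0 ≤ i → i < n → ω i = ω' i) →
    fibIter F n ω = fibIter F n ω' := by
  induction n with
  | zero => intro ω ω' _; rfl
  | succ n ih =>
    intro ω ω' H
    funext x
    simp only [fibIter]
    rw [hF ω, hF ω', H 0 le_rfl (by positivity), ih (shiftZ ω) (shiftZ ω')]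
    intro i h0 h1
    exact H (i + 1) (by omega) (by push_cast; omega)
end det

section prob
variable {k : ℕ}

lemma exists_factor (hk : 0 < k) (S : Finset ℤ) (X : (ℤ → Fin k) → ℝ)
    (hX : ∀ ω ω', (∀ i ∈ S, ω i = ω' i) → X ω = X ω') :
    ∃ φ : (S → Fin k) → ℝ, X = fun ω => φ (fun i : S => ω i) := by
  refine ⟨fun w => X (fun i => if h : i ∈ S then w ⟨i, h⟩ else ⟨0, hk⟩), ?_⟩
  funext ω
  apply hX
  intro i hi
  simp [hi]

lemma bern_eq (hk : 0 < k) (ν : Measure (ℤ → Fin k))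
    (hbern : ∀ (s : Finset ℤ) (c : ℤ → Fin k),
      ν {ω | ∀ i ∈ s, ω i = c i} = (1 / (k : ENNReal)) ^ s.card)
    (P : Measure (Fin k)) [IsProbabilityMeasure P] (hP : ∀ a, P {a} = 1 / (k : ENNReal)) :
    ν = Measure.infinitePi (fun _ : ℤ => P) := by
  refine IsProjectiveLimit.unique (P := fun I : Finset ℤ => Measure.pi (fun _ : I => P)) ?_
    (Measure.isProjectiveLimit_infinitePi _)
  intro I
  refine Measure.ext_of_singleton fun a => ?_
  rw [Measure.pi_singleton, Measure.map_apply (by fun_prop) (measurableSet_singleton _)]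
  simp only [hP, Finset.prod_const, Finset.card_univ, Fintype.card_coe]
  rw [← hbern I (fun i => if h : i ∈ I then a ⟨i, h⟩ else ⟨0, hk⟩)]
  congr 1
  ext ω
  simp only [mem_preimage, mem_singleton_iff, mem_setOf_eq, funext_iff, Finset.restrict]
  constructor
  · intro H i hi
    simpa [hi] using H ⟨i, hi⟩
  · intro H i
    simpa using H i.1 i.2

lemma slln (hk : 0 < k) (ν : Measure (ℤ → Fin k)) [IsProbabilityMeasure ν]
    (hbern : ∀ (s : Finset ℤ) (c : ℤ → Fin k),
      ν {ω | ∀ i ∈ s, ω i = c i} = (1 / (k : ENNReal)) ^ s.card)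
    (N : ℕ) (X : (ℤ → Fin k) → ℝ)
    (hX : ∀ ω ω', (∀ i : ℤ, 0 ≤ i → i < N → ω i = ω' i) → X ω = X ω')
    (C : ℝ) (hC : ∀ ω, |X ω| ≤ C) :
    ∀ᵐ ω ∂ν, Tendsto (fun n : ℕ => (∑ j ∈ Finset.range n, X (shiftZ^[N * j] ω)) / n) atTop
      (𝓝 (∫ ω, X ω ∂ν)) := by
  haveI : Nonempty (Fin k) := ⟨⟨0, hk⟩⟩
  let P : Measure (Fin k) := (PMF.uniformOfFintype (Fin k)).toMeasure
  have hP : ∀ a, P {a} = 1 / (k : ENNReal) := by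
    intro a
    simp [P, PMF.toMeasure_apply_singleton]
  have hν := bern_eq hk ν hbern P hP
  have hdep : ∀ j : ℕ, ∃ φ : ((Finset.Ico ((N * j : ℕ) : ℤ) ((N * j + N : ℕ) : ℤ)) → Fin k) → ℝ,
      (fun ω => X (shiftZ^[N * j] ω)) = fun ω => φ (fun i => ω i) := by
    intro j
    apply exists_factor hk
    intro ω ω' H
    apply hX
    intro i h0 h1
    rw [shift_iter, shift_iter]
    apply H
    rw [Finset.mem_Ico]
    push_cast
    constructor <;> linarith
  choose φ hφ using hdep
  have hmeas : ∀ j, Measurable (fun ω => X (shiftZ^[N * j] ω)) := by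
    intro j
    rw [hφ j]
    exact (measurable_of_finite (φ j)).comp (by fun_prop)
  have hmeas0 : Measurable X := by simpa using hmeas 0
  have hsh : ∀ m : ℕ, MeasurePreserving (shiftZ^[m] : (ℤ → Fin k) → _) ν ν := by
    intro m
    have e : (shiftZ^[m] : (ℤ → Fin k) → _) = fun ω i => ω (i + m) := by
      funext ω; exact shift_iter m ω
    refine ⟨by rw [e]; fun_prop, ?_⟩
    rw [e, hν]
    exact Measure.map_infinitePi_infinitePi_of_inj (P := fun _ : ℤ => P)
      (f := fun i : ℤ => i + m) (add_left_injective _)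
  have hind : ProbabilityTheory.iIndepFun (fun (i : ℤ) (ω : ℤ → Fin k) => ω i) ν := by
    rw [hν]
    exact ProbabilityTheory.iIndepFun_infinitePi (P := fun _ : ℤ => P)
      (X := fun _ ω => ω) (by fun_prop)
  have := ProbabilityTheory.strong_law_ae_real (μ := ν) (fun j ω => X (shiftZ^[N * j] ω))
    (by
      refine Integrable.of_bound (hmeas 0).aestronglyMeasurable C (ae_of_all _ fun ω => hC _))
    (by
      intro i j hij
      simp only [Function.onFun]
      rw [hφ i, hφ j]
      refine (hind.indepFun_finset _ _ ?_ (by fun_prop)).comp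
        (measurable_of_finite (φ i)) (measurable_of_finite (φ j))
      rw [Finset.disjoint_left]
      intro a ha hb
      rw [Finset.mem_Ico] at ha hb
      obtain ⟨a1, a2⟩ := ha
      obtain ⟨b1, b2⟩ := hb
      have h1 : N * i < N * j + N := by exact_mod_cast a1.trans_lt b2
      have h2 : N * j < N * i + N := by exact_mod_cast b1.trans_lt a2
      rw [← Nat.mul_succ] at h1 h2
      have h1' := lt_of_mul_lt_mul_left h1 (Nat.zero_le _)
      have h2' := lt_of_mul_lt_mul_left h2 (Nat.zero_le _)
      omega)
    (by
      intro i
      have h1 : ∀ m : ℕ, Measure.map (fun ω => X (shiftZ^[m] ω)) ν = Measure.map X ν := by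
        intro m
        have := Measure.map_map (μ := ν) hmeas0 (hsh m).measurable
        rw [(hsh m).map_eq] at this
        exact this.symm
      exact ⟨(hmeas i).aemeasurable, (hmeas 0).aemeasurable, by rw [h1, h1]⟩)
  simpa using this
end prob

/-- Stability of the negative fiber Lyapunov exponent: if the step skew product `F`
with `C¹` fiber maps `f_i` of positive derivative has a.s. fiber Lyapunov exponent
`λ < 0`, then for any (sufficiently small) `ε > 0` there is `δ > 0` such that every
skew product `G` whose fiber maps are `δ`-close to those of `F` in the `C¹` distance
has a.s. fiber Lyapunov exponent `limsup (1/n) log ‖g^n(ω,·)‖ ≤ λ + ε < 0`. -/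
theorem lyapunov_exponent_stable_under_perturbation
    {k : ℕ} (hk : 0 < k) (f f' : Fin k → ℝ → ℝ)
    (hmaps : ∀ i, MapsTo (f i) (Icc (0:ℝ) 1) (Icc (0:ℝ) 1))
    (hd : ∀ i, ∀ x ∈ Icc (0:ℝ) 1, HasDerivAt (f i) (f' i x) x)
    (hc : ∀ i, ContinuousOn (f' i) (Icc (0:ℝ) 1))
    (hpos : ∀ i, ∀ x ∈ Icc (0:ℝ) 1, 0 < f' i x)
    (ν : Measure (ℤ → Fin k)) [IsProbabilityMeasure ν]
    (hbern : ∀ (s : Finset ℤ) (c : ℤ → Fin k),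
      ν {ω | ∀ i ∈ s, ω i = c i} = (1 / (k : ENNReal)) ^ s.card)
    (F : (ℤ → Fin k) → ℝ → ℝ) (hF : ∀ ω, F ω = f (ω 0))
    (lam : ℝ)
    (hlyap : ∀ᵐ ω ∂ν, Tendsto
      (fun n : ℕ => (1 / (n : ℝ)) * Real.log (lipSemi (fibIter F n ω))) atTop (𝓝 lam))
    (ε : ℝ) (hε : 0 < ε) (hεsmall : lam + ε < 0) :
    ∃ δ : ℝ, 0 < δ ∧
      ∀ (g g' : (ℤ → Fin k) → ℝ → ℝ),
        (∀ ω, MapsTo (g ω) (Icc (0:ℝ) 1) (Icc (0:ℝ) 1)) →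
        (∀ ω, ∀ x ∈ Icc (0:ℝ) 1, HasDerivAt (g ω) (g' ω x) x) →
        (∀ ω, ∀ x ∈ Icc (0:ℝ) 1,
          |g ω x - f (ω 0) x| < δ ∧ |g' ω x - f' (ω 0) x| < δ) →
        ∀ᵐ ω ∂ν, Filter.limsup
            (fun n : ℕ => (1 / (n : ℝ)) * Real.log (lipSemi (fibIter g n ω))) atTop
          ≤ lam + ε := by
  -- uniform constants for `f`
  have hne : (Icc (0:ℝ) 1).Nonempty := ⟨0, by simp⟩
  haveI : Nonempty (Fin k) := ⟨⟨0, hk⟩⟩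
  have hcM : ∃ c M : ℝ, 0 < c ∧ c ≤ 1 ∧ 1 ≤ M ∧
      ∀ i, ∀ x ∈ Icc (0:ℝ) 1, c ≤ f' i x ∧ f' i x ≤ M := by
    have h1 : ∀ i, ∃ x ∈ Icc (0:ℝ) 1, ∀ y ∈ Icc (0:ℝ) 1, f' i x ≤ f' i y := fun i => by
      obtain ⟨x, hx, h⟩ := isCompact_Icc.exists_isMinOn hne (hc i)
      exact ⟨x, hx, fun y hy => h hy⟩
    have h2 : ∀ i, ∃ x ∈ Icc (0:ℝ) 1, ∀ y ∈ Icc (0:ℝ) 1, f' i y ≤ f' i x := fun i => by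
      obtain ⟨x, hx, h⟩ := isCompact_Icc.exists_isMaxOn hne (hc i)
      exact ⟨x, hx, fun y hy => h hy⟩
    choose a ha ha' using h1
    choose b hb hb' using h2
    obtain ⟨i0, hi0⟩ := Finite.exists_min (fun i => f' i (a i))
    obtain ⟨j0, hj0⟩ := Finite.exists_max (fun i => f' i (b i))
    refine ⟨min 1 (f' i0 (a i0)), max 1 (f' j0 (b j0)), ?_, min_le_left _ _, le_max_left _ _, ?_⟩
    · exact lt_min one_pos (hpos _ _ (ha _))
    · intro i x hx
      exact ⟨(min_le_right _ _).trans ((hi0 i).trans (ha' i x hx)),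
        ((hb' i x hx).trans (hj0 i)).trans (le_max_right _ _)⟩
  obtain ⟨c, M, hc0, hc1, hM1, hcM⟩ := hcM
  have huc : ∀ η > 0, ∃ θ > 0, ∀ ω : ℤ → Fin k, ∀ x ∈ Icc (0:ℝ) 1, ∀ y ∈ Icc (0:ℝ) 1,
      |x - y| < θ → |f' (ω 0) x - f' (ω 0) y| < η := by
    intro η hη
    have h1 : ∀ i, ∃ θ > 0, ∀ x ∈ Icc (0:ℝ) 1, ∀ y ∈ Icc (0:ℝ) 1,
        |x - y| < θ → |f' i x - f' i y| < η := fun i => by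
      have := Metric.uniformContinuousOn_iff.1
        (isCompact_Icc.uniformContinuousOn_of_continuous (hc i)) η hη
      simpa only [Real.dist_eq] using this
    choose θ hθ hθ' using h1
    obtain ⟨i0, hi0⟩ := Finite.exists_min θ
    exact ⟨θ i0, hθ i0, fun ω x hx y hy hxy =>
      hθ' (ω 0) x hx y hy (hxy.trans_le (hi0 _))⟩
  have hgood : Good F (fun ω => f' (ω 0)) c M :=
    ⟨fun ω => by rw [hF]; exact hmaps _, fun ω => by rw [hF]; exact hd _, hc0, hc1, hM1,
      fun ω x hx => (hcM _ x hx).1, fun ω x hx => (hcM _ x hx).2⟩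
  -- dominated convergence
  have hlogc : Real.log c ≤ 0 := Real.log_nonpos hc0.le hc1
  have hlogM : 0 ≤ Real.log M := Real.log_nonneg hM1
  have habs : ∀ (n : ℕ) ω, |Real.log (lipSemi (fibIter F n ω))|
      ≤ n * (Real.log M - Real.log c) := by
    intro n ω
    have h1 := hgood.log_lb n ω
    have h2 := hgood.log_ub n ω
    have h3 : (n : ℝ) * Real.log c ≤ 0 := mul_nonpos_of_nonneg_of_nonpos (by positivity) hlogc
    have h4 : 0 ≤ (n : ℝ) * Real.log M := by positivity
    rw [abs_le]
    constructor <;> nlinarith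
  have hcongr : ∀ n : ℕ, ∀ ω ω' : ℤ → Fin k, (∀ i : ℤ, 0 ≤ i → i < n → ω i = ω' i) →
      Real.log (lipSemi (fibIter F n ω)) = Real.log (lipSemi (fibIter F n ω')) := by
    intro n ω ω' H
    rw [fibIter_congr hF n ω ω' H]
  have hmeas : ∀ n : ℕ, Measurable (fun ω => Real.log (lipSemi (fibIter F n ω))) := by
    intro n
    obtain ⟨φ, hφ⟩ := exists_factor hk (Finset.Ico (0:ℤ) n)
      (fun ω => Real.log (lipSemi (fibIter F n ω))) (by
        intro ω ω' H
        exact hcongr n ω ω' fun i h0 h1 => H i (Finset.mem_Ico.2 ⟨h0, h1⟩))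
    rw [hφ]
    exact (measurable_of_finite φ).comp (by fun_prop)
  have hDCT := tendsto_integral_of_dominated_convergence (μ := ν)
    (F := fun (n : ℕ) ω => (1 / (n : ℝ)) * Real.log (lipSemi (fibIter F n ω)))
    (f := fun _ => lam) (fun _ => Real.log M - Real.log c)
    (fun n => ((hmeas n).const_mul _).aestronglyMeasurable) (integrable_const _)
    (fun n => ae_of_all _ fun ω => by
      rw [Real.norm_eq_abs, abs_mul, abs_of_nonneg (by positivity)]
      rcases Nat.eq_zero_or_pos n with rfl | hn
      · simp; linarith
      · have : (0:ℝ) < n := by exact_mod_cast hn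
        rw [one_div, inv_mul_le_iff₀ this]
        exact habs n ω) hlyap
  simp only [integral_const, probReal_univ, one_smul] at hDCT
  obtain ⟨N, hNint, hN⟩ := ((hDCT.eventually (gt_mem_nhds (show lam < lam + ε / 3 by linarith))).and
    (eventually_gt_atTop 0)).exists
  rw [integral_const_mul] at hNint
  have hN' : (0:ℝ) < N := by exact_mod_cast hN
  obtain ⟨ρ, hρ, δ, hδ, H⟩ := perturb hgood huc (ε / 3) (by positivity) N
  refine ⟨min δ (min (c / 2) 1), by positivity, ?_⟩
  intro g g' hgm hgd hclose
  have hgg : Good g g' (c / 2) (M + 1) := by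
    refine ⟨hgm, hgd, by positivity, by linarith, by linarith, ?_, ?_⟩
    · intro ω x hx
      have h1 := (hclose ω x hx).2.trans_le ((min_le_right _ _).trans (min_le_left _ _))
      have h2 := (abs_lt.1 h1).1
      have h3 := (hcM (ω 0) x hx).1
      linarith
    · intro ω x hx
      have h1 := (hclose ω x hx).2.trans_le ((min_le_right _ _).trans (min_le_right _ _))
      have h2 := (abs_lt.1 h1).2
      have h3 := (hcM (ω 0) x hx).2
      linarith
  have hL : ∀ ω, ∀ x ∈ Icc (0:ℝ) 1,
      dCoc g g' N ω x ≤ (1 + ε / 3) ^ N * lipSemi (fibIter F N ω) := by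
    intro ω x hx
    have h1 := H g g' _ _ hgg (fun ω x hx => by
      rw [hF]
      exact ⟨(hclose ω x hx).1.trans_le (min_le_left _ _),
        (hclose ω x hx).2.trans_le (min_le_left _ _)⟩) ω x hx x hx (by simpa using hρ)
    exact h1.trans (mul_le_mul_of_nonneg_left (hgood.le_lip N ω x hx) (by positivity))
  have hlogL : ∀ ω, Real.log ((1 + ε / 3) ^ N * lipSemi (fibIter F N ω)) ≤
      N * (ε / 3) + Real.log (lipSemi (fibIter F N ω)) := by
    intro ω
    rw [Real.log_mul (by positivity) (hgood.lip_pos N ω).ne', Real.log_pow]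
    have := Real.log_le_sub_one_of_pos (show 0 < 1 + ε / 3 by positivity)
    have h2 : Real.log (1 + ε / 3) ≤ ε / 3 := by linarith
    gcongr
  filter_upwards [slln hk ν hbern N (fun ω => Real.log (lipSemi (fibIter F N ω))) (hcongr N)
    _ (habs N)] with ω hω
  have hdivtop : Tendsto (fun n : ℕ => n / N) atTop atTop := Nat.tendsto_div_const_atTop hN.ne'
  have hratio : Tendsto (fun n : ℕ => ((n / N : ℕ) : ℝ) / n) atTop (𝓝 (1 / (N : ℝ))) := by
    have := (tendsto_nat_floor_mul_div_atTop (R := ℝ) (a := 1 / (N : ℝ)) (by positivity)).comp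
      tendsto_natCast_atTop_atTop
    refine this.congr fun n => ?_
    simp only [Function.comp]
    rw [one_div_mul_eq_div, Nat.floor_div_eq_div]
  have hlim := (hratio.mul ((hω.comp hdivtop).const_add ((N : ℝ) * (ε / 3)))).add
    (tendsto_const_div_atTop_nhds_zero_nat ((N : ℝ) * Real.log (M + 1)))
  refine limsup_le_of_le ?_ ?_
  · refine IsBoundedUnder.isCoboundedUnder_le ⟨Real.log (c / 2), ?_⟩
    rw [eventually_map]
    filter_upwards [eventually_gt_atTop 0] with n hn
    have hn' : (0:ℝ) < n := by exact_mod_cast hn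
    rw [one_div, le_inv_mul_iff₀ hn']
    exact hgg.log_lb n ω
  · have hlt : 1 / (N : ℝ) * (N * (ε / 3) + ∫ ω, Real.log (lipSemi (fibIter F N ω)) ∂ν) + 0
        < lam + ε := by
      have : 1 / (N : ℝ) * (N * (ε / 3)) = ε / 3 := by field_simp
      rw [mul_add, this]
      linarith
    filter_upwards [hlim.eventually (gt_mem_nhds hlt), eventually_ge_atTop N] with n hn hnN
    refine le_trans ?_ hn.le
    have hn' : (0:ℝ) < n := by exact_mod_cast hN.trans_le hnN
    have hm : (0:ℝ) < ((n / N : ℕ) : ℝ) := by exact_mod_cast Nat.div_pos hnN hN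
    have h1 := hgg.log_block N hN _ hL n ω
    have h2 := Finset.sum_le_sum (s := Finset.range (n / N))
      (fun j _ => hlogL (shiftZ^[N * j] ω))
    rw [Finset.sum_add_distrib, Finset.sum_const, Finset.card_range, nsmul_eq_mul] at h2
    have h3 := h1.trans (add_le_add_left h2 _)
    simp only [Function.comp]
    rw [one_div, inv_mul_le_iff₀ hn']
    refine h3.trans (le_of_eq ?_)
    field_simp
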